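/- Every finite right distributive centrally essential ring is commutative. -/

import Mathlib

/-- A ring `A` is *centrally essential* if for every nonzero `a ∈ A` there exist
nonzero central elements `c, d ∈ A` with `a * c = d`. -/
def IsCentrallyEssential (A : Type*) [Ring A] : Prop :=
  ∀ a : A, a ≠ 0 → ∃ c d : A, c ∈ Set.center A ∧ d ∈ Set.center A ∧
    c ≠ 0 ∧ d ≠ 0 ∧ a * c = d

/-- A ring is *right distributive* if the lattice of its right ideals is distributive. -/
def IsRightDistributive (A : Type*) [Ring A] : Prop :=
  ∀ I J K : Submodule Aᵐᵒᵖ A, I ⊓ (J ⊔ K) = (I ⊓ J) ⊔ (I ⊓ K)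

open Finset in
/-- If `θ ^ m = 1`, averaging an element over conjugation by `θ` gives an element
commuting with `θ`. -/
theorem commute_sum_pow_mul_mul_pow {A : Type*} [Ring A] {θ : A} {m : ℕ} (hθ : θ ^ m = 1)
    (a : A) : Commute θ (∑ i ∈ range m, θ ^ i * a * θ ^ (m - i)) := by
  have h := (sum_range_succ (fun i => θ ^ i * a * θ ^ (m - i)) m).symm.trans
    (sum_range_succ' (fun i => θ ^ i * a * θ ^ (m - i)) m)
  simp only [hθ, Nat.sub_self, pow_zero, one_mul, mul_one, Nat.sub_zero] at h
  rw [Commute, SemiconjBy, mul_sum, sum_mul]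
  rw [add_right_cancel_iff] at h
  calc _ = ∑ i ∈ range m, θ ^ (i + 1) * a * θ ^ (m - (i + 1)) * θ := by
        refine sum_congr rfl fun i hi => ?_
        have : m - i = m - (i + 1) + 1 := by have := mem_range.1 hi; omega
        rw [this, pow_succ' θ i, pow_succ θ (m - (i + 1))]
        simp only [mul_assoc]
    _ = _ := by rw [← sum_mul, ← h, sum_mul]

/-- A finite ring without zero divisors is a field whose nonzero elements are powers of
a single element. -/
theorem exists_generator_of_finite_isDomain (K : Type*) [Ring K] [IsDomain K] [Finite K] :
    ∃ (p q : ℕ) (g : K), p.Prime ∧ CharP K p ∧ p ∣ q ∧ (∀ x : K, x ^ q = x) ∧ g ≠ 0 ∧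
      (∀ x : K, x ≠ 0 → ∃ i : ℕ, x = g ^ i) := by
  let _ : Field K := (Finite.isDomain_to_isField K).toField
  cases nonempty_fintype K
  obtain ⟨p, hp⟩ := CharP.exists K
  obtain ⟨n, hpp, hn⟩ := FiniteField.card K p
  obtain ⟨g, hg⟩ := IsCyclic.exists_monoid_generator (α := Kˣ)
  refine ⟨p, Fintype.card K, g, hpp, hp, hn ▸ dvd_pow_self p n.ne_zero, FiniteField.pow_card,
    g.ne_zero, fun x hx => ?_⟩
  obtain ⟨i, hi⟩ := Submonoid.mem_powers_iff _ _ |>.1 (hg (Units.mk0 x hx))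
  exact ⟨i, by simpa using (congrArg Units.val hi).symm⟩

theorem exists_pow_isIdempotentElem {M : Type*} [Monoid M] [Finite M] (a : M) :
    ∃ n, n ≠ 0 ∧ IsIdempotentElem (a ^ n) := by
  obtain ⟨i, j, hij, h⟩ := Finite.exists_ne_map_eq_of_infinite fun i : ℕ => a ^ (i + 1)
  wlog hlt : i < j generalizing i j
  · exact this j i hij.symm h.symm (by omega)
  obtain ⟨k, rfl⟩ := Nat.exists_eq_add_of_lt hlt
  have h1 : ∀ l, a ^ (i + 1 + l * (k + 1)) = a ^ (i + 1) := by
    intro l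
    induction l with
    | zero => simp
    | succ l ih =>
      rw [show i + 1 + (l + 1) * (k + 1) = i + k + 1 + 1 + l * (k + 1) by ring, pow_add, ← h,
        ← pow_add, ih]
  refine ⟨(i + 1) * (k + 1), by positivity, ?_⟩
  rw [IsIdempotentElem, ← pow_add,
    show (i + 1) * (k + 1) + (i + 1) * (k + 1) = (i + 1 + (i + 1) * (k + 1)) + (i + 1) * k by ring,
    pow_add, h1, ← pow_add]
  congr 1
  ring

/-- In a right distributive ring, `a * x ∈ b * A` and `b * y ∈ a * A` for suitable
`x + y = 1`. -/
theorem IsRightDistributive.exists_add_eq_one {A : Type*} [Ring A] (h : IsRightDistributive A)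
    (a b : A) : ∃ x y : A, x + y = 1 ∧ b ∣ a * x ∧ a ∣ b * y := by
  have hmem : a + b ∈ Submodule.span Aᵐᵒᵖ {a + b} ⊓
      (Submodule.span Aᵐᵒᵖ {a} ⊔ Submodule.span Aᵐᵒᵖ {b}) :=
    ⟨Submodule.mem_span_singleton_self _, Submodule.add_mem_sup
      (Submodule.mem_span_singleton_self _) (Submodule.mem_span_singleton_self _)⟩
  rw [h, Submodule.mem_sup] at hmem
  obtain ⟨_, ⟨hu, hua⟩, _, ⟨hv, hvb⟩, huv⟩ := hmem
  obtain ⟨u, rfl⟩ := Submodule.mem_span_singleton.1 hu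
  obtain ⟨v, rfl⟩ := Submodule.mem_span_singleton.1 hv
  obtain ⟨s, hs⟩ := Submodule.mem_span_singleton.1 hua
  obtain ⟨t, ht⟩ := Submodule.mem_span_singleton.1 hvb
  induction u using MulOpposite.rec' with | _ u
  induction v using MulOpposite.rec' with | _ v
  induction s using MulOpposite.rec' with | _ s
  induction t using MulOpposite.rec' with | _ t
  simp only [MulOpposite.smul_eq_mul_unop, MulOpposite.unop_op] at hs ht huv
  refine ⟨1 - u, u, by simp, ⟨t - v - (1 - u - v), ?_⟩, ⟨s - u, ?_⟩⟩
  · have : a * (1 - u) = (a + b) * v - b * v + ((a + b) * (1 - u - v) - b * (1 - u - v)) := by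
      noncomm_ring
    have h0 : (a + b) * (1 - u - v) = 0 := by
      rw [mul_sub, mul_sub, mul_one, sub_sub, huv, sub_self]
    rw [this, ← ht, h0]
    noncomm_ring
  · rw [mul_sub, hs]
    noncomm_ring

theorem IsCentrallyEssential.mul_comm_of_isIdempotentElem {A : Type*} [Ring A]
    (hA : IsCentrallyEssential A) {e : A} (he : IsIdempotentElem e) (x : A) :
    e * x = x * e := by
  have key : ∀ e : A, IsIdempotentElem e → e * x * (1 - e) = 0 := by
    intro e he
    by_contra hne
    obtain ⟨c, d, hc, hd, -, hd0, h⟩ := hA _ hne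
    have h1 : e * d = d := by rw [← h]; simp only [← mul_assoc, he.eq]
    have h2 : d * e = 0 := by
      rw [← h, mul_assoc, (Semigroup.mem_center_iff.1 hc e).symm, ← mul_assoc, mul_assoc (e * x),
        sub_mul, one_mul, he.eq, sub_self, mul_zero, zero_mul]
    exact hd0 (by rw [← h1, Semigroup.mem_center_iff.1 hd e, h2])
  have h1 := key e he
  have h2 := key (1 - e) he.one_sub
  have h3 : e * x = e * x * e := sub_eq_zero.1 (by rw [← h1]; noncomm_ring)
  have h4 : x * e = e * x * e := sub_eq_zero.1 (by rw [← h2]; noncomm_ring)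
  rw [h3, ← h4]

section Local

variable {A : Type*} [Ring A] {π : A}

/-- If the nonunits of a finite ring form the right ideal generated by a nilpotent `π`, then
modulo `π` the ring has a generator `θ` whose multiplicative order is invertible. -/
theorem exists_generator_mod [Finite A] (hπ : ∀ x, ¬IsUnit x ↔ π ∣ x) :
    ∃ (θ : A) (m : ℕ), θ ^ m = 1 ∧ IsUnit (m : A) ∧ ∀ x, π ∣ x ∨ ∃ i : ℕ, π ∣ x - θ ^ i := by
  have hleft : ∀ a {x}, π ∣ x → π ∣ a * x := fun a x hx => by
    rw [← hπ] at hx ⊢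
    exact fun h => hx (isUnit_of_mul_isUnit_right h)
  let J : Ideal A :=
    { carrier := {x | π ∣ x}
      add_mem' := dvd_add
      zero_mem' := dvd_zero _
      smul_mem' := fun a _ hx => hleft a hx }
  have hJ : ∀ x, x ∈ J ↔ π ∣ x := fun _ => Iff.rfl
  have : J.IsTwoSided := ⟨fun b ha => Dvd.dvd.mul_right ha b⟩
  have hmk : ∀ x, Ideal.Quotient.mk J x = 0 ↔ π ∣ x := fun x => Ideal.Quotient.eq_zero_iff_mem
  have : Nontrivial (A ⧸ J) := ⟨1, 0, fun h => by
    rw [← map_one (Ideal.Quotient.mk J), hmk, ← hπ] at h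
    exact h isUnit_one⟩
  have : NoZeroDivisors (A ⧸ J) := ⟨fun {a b} h => by
    obtain ⟨a, rfl⟩ := Ideal.Quotient.mk_surjective a
    obtain ⟨b, rfl⟩ := Ideal.Quotient.mk_surjective b
    rw [← map_mul, hmk, ← hπ] at h
    rw [hmk, hmk, ← hπ, ← hπ]
    by_contra! hab
    exact h (hab.1.mul hab.2)⟩
  have : IsDomain (A ⧸ J) := NoZeroDivisors.to_isDomain _
  have : Finite (A ⧸ J) := Finite.of_surjective _ Ideal.Quotient.mk_surjective
  obtain ⟨p, q, g, hp, hchar, hpq, hq, hg0, hg⟩ := exists_generator_of_finite_isDomain (A ⧸ J)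
  obtain ⟨u, rfl⟩ := Ideal.Quotient.mk_surjective g
  have hu : IsUnit u := by
    by_contra h
    exact hg0 ((hmk u).2 ((hπ u).1 h))
  obtain ⟨u, rfl⟩ := hu
  obtain ⟨k, m, hm, ho⟩ := Nat.exists_eq_pow_mul_and_not_dvd (orderOf_pos u).ne' p hp.ne_one
  have hqk : ∀ (k : ℕ) (x : A ⧸ J), x ^ q ^ k = x := by
    intro k x
    induction k with
    | zero => simp
    | succ k ih => rw [pow_succ, pow_mul, ih, hq]
  refine ⟨(u : A) ^ q ^ k, m, ?_, ?_, fun x => ?_⟩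
  · rw [← pow_mul, ← Units.val_pow_eq_pow_val, orderOf_dvd_iff_pow_eq_one.1, Units.val_one]
    rw [ho]
    exact mul_dvd_mul_right (pow_dvd_pow_of_dvd hpq k) m
  · by_contra h
    rw [hπ, ← hmk, map_natCast, CharP.cast_eq_zero_iff (A ⧸ J) p] at h
    exact hm h
  · by_cases hx : π ∣ x
    · exact Or.inl hx
    · obtain ⟨i, hi⟩ := hg (Ideal.Quotient.mk J x) (by rwa [Ne, hmk])
      refine Or.inr ⟨i, ?_⟩
      rw [← hmk, map_sub, map_pow, map_pow, hqk, hi, sub_self]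

/-- A ring generated modulo `π` by an element commuting with the nilpotent `π` is
commutative. -/
theorem mul_comm_of_commute_generator {θ : A} (hnil : IsNilpotent π) (hθ : Commute θ π)
    (hgen : ∀ x, π ∣ x ∨ ∃ i : ℕ, π ∣ x - θ ^ i) (x y : A) : x * y = y * x := by
  set S := Subring.closure {θ, π} with hS
  have hθS : θ ∈ S := Subring.subset_closure (by simp)
  have hπS : π ∈ S := Subring.subset_closure (by simp)
  have hdecomp : ∀ x, ∃ s ∈ S, π ∣ x - s := fun x => by
    rcases hgen x with h | ⟨i, h⟩
    · exact ⟨0, zero_mem _, by simpa using h⟩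
    · exact ⟨_, pow_mem hθS i, h⟩
  have hpow : ∀ k : ℕ, ∀ x, ∃ s ∈ S, π ^ k ∣ x - s := by
    intro k
    induction k with
    | zero => exact fun x => ⟨0, zero_mem _, by simp⟩
    | succ k ih =>
      intro x
      obtain ⟨s, hs, y, hy⟩ := ih x
      obtain ⟨t, ht, z, hz⟩ := hdecomp y
      refine ⟨s + π ^ k * t, add_mem hs (mul_mem (pow_mem hπS k) ht), z, ?_⟩
      rw [← sub_sub, hy, ← mul_sub, hz, pow_succ, mul_assoc]
  have hmem : ∀ x, x ∈ S := fun x => by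
    obtain ⟨n, hn⟩ := hnil
    obtain ⟨s, hs, h⟩ := hpow n x
    rw [hn, zero_dvd_iff, sub_eq_zero] at h
    rwa [h]
  have := Subring.isMulCommutative_closure (R := A) (s := {θ, π}) (by
    rintro a (rfl | rfl) b (rfl | rfl)
    exacts [rfl, hθ.eq, hθ.eq.symm, rfl])
  exact setLike_mul_comm (hmem x) (hmem y)

/-- If the nonunits of a finite centrally essential ring form the right ideal generated by a
nilpotent `π`, the ring is commutative. -/
theorem IsCentrallyEssential.mul_comm_of_nonunits_eq [Finite A] (hA : IsCentrallyEssential A)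
    (hnil : IsNilpotent π) (hπ : ∀ x, ¬IsUnit x ↔ π ∣ x) (x y : A) : x * y = y * x := by
  have hleft : ∀ a {x}, π ∣ x → π ∣ a * x := fun a x hx => by
    rw [← hπ] at hx ⊢
    exact fun h => hx (isUnit_of_mul_isUnit_right h)
  obtain ⟨θ, m, hθ, hm, hgen⟩ := exists_generator_mod hπ
  suffices h : ∃ w, IsUnit w ∧ Commute θ (π * w) by
    obtain ⟨_, ⟨w, rfl⟩, hw⟩ := h
    have hdvd : ∀ a, π ∣ a ↔ π * w ∣ a := fun a => Units.mul_right_dvd.symm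
    refine mul_comm_of_commute_generator (π := π * w) ?_ hw (by simpa only [hdvd] using hgen) x y
    obtain ⟨k, hk⟩ := hnil
    refine ⟨k, zero_dvd_iff.1 (hk ▸ ?_)⟩
    clear hk
    induction k with
    | zero => simp
    | succ k ih =>
      obtain ⟨b, hb⟩ := ih
      obtain ⟨c, hc⟩ := hleft b (dvd_mul_right π w)
      exact ⟨c, by rw [pow_succ, hb, mul_assoc, hc, pow_succ, mul_assoc]⟩
  by_cases hc : ∃ c ∈ Set.center A, π ∣ c ∧ ¬ π ^ 2 ∣ c
  · obtain ⟨_, hcent, ⟨w, rfl⟩, hw⟩ := hc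
    refine ⟨w, ?_, (Semigroup.mem_center_iff.1 hcent θ)⟩
    by_contra h
    obtain ⟨v, rfl⟩ := (hπ w).1 h
    exact hw ⟨v, by rw [pow_two, mul_assoc]⟩
  push Not at hc
  have hleftpow : ∀ n : ℕ, ∀ a, π ^ n ∣ a * π ^ n := fun n => by
    induction n with
    | zero => simp
    | succ n ih =>
      intro a
      obtain ⟨b, hb⟩ := ih a
      obtain ⟨c, hc⟩ := hleft b (dvd_refl π)
      exact ⟨c, by rw [pow_succ, ← mul_assoc, hb, mul_assoc, hc, mul_assoc]⟩
  have hcomm : ∀ a, π ^ 2 ∣ a * π - π * a := by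
    by_cases h0 : π = 0
    · simp [h0]
    have : Nontrivial A := nontrivial_of_ne π 0 h0
    obtain ⟨n, hn, hn1⟩ : ∃ n : ℕ, π ^ (n + 2) = 0 ∧ π ^ (n + 1) ≠ 0 := by
      obtain ⟨n, hn⟩ : ∃ n, nilpotencyClass π = n + 2 :=
        Nat.exists_eq_add_of_le' (Nat.lt_of_le_of_ne
          (pos_nilpotencyClass_iff.2 hnil) fun h => h0 (nilpotencyClass_eq_one.1 h.symm))
      exact ⟨n, hn ▸ pow_nilpotencyClass hnil,
        by simpa [hn] using pow_pred_nilpotencyClass hnil⟩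
    have hcent : ∀ s, π ^ n ∣ s → ∀ a, a * s = s * a := by
      rintro _ ⟨b, rfl⟩ a
      by_cases hs : π ^ n * b = 0
      · simp [hs]
      obtain ⟨c, d, hcc, hd, -, hd0, h⟩ := hA _ hs
      have hcu : IsUnit c := by
        by_contra hcu
        obtain ⟨e, rfl⟩ := hc c hcc ((hπ c).1 hcu)
        obtain ⟨f, hf⟩ := hleftpow 2 b
        refine hd0 ?_
        rw [← h, mul_assoc, ← mul_assoc b, hf, mul_assoc, ← mul_assoc, ← pow_add, hn, zero_mul]
      rw [← hcu.mul_left_inj, mul_assoc, h, mul_assoc, Semigroup.mem_center_iff.1 hcc a,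
        ← mul_assoc, h, Semigroup.mem_center_iff.1 hd a]
    intro a
    have hz : π ^ n * (a * π - π * a) = 0 := by
      rw [← hcent _ dvd_rfl, sub_mul, mul_assoc, hcent _ (hleftpow n π) a, mul_assoc π,
        ← hcent _ dvd_rfl a, mul_assoc, sub_self]
    have hnu : ∀ k x, k ≤ n + 1 → π ^ k * x = 0 → π ∣ x := by
      intro k x hk h
      rw [← hπ]
      intro hx
      rw [hx.mul_left_eq_zero] at h
      exact hn1 (pow_eq_zero_of_le hk h)
    obtain ⟨z, hz'⟩ := hnu n _ (by omega) hz
    rw [hz', ← mul_assoc, ← pow_succ] at hz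
    obtain ⟨w, rfl⟩ := hnu _ _ le_rfl hz
    exact ⟨w, by rw [hz', pow_two, mul_assoc]⟩
  have hsum : π ^ 2 ∣ (∑ i ∈ Finset.range m, θ ^ i * π * θ ^ (m - i)) - π * m := by
    have hconst : π * m = ∑ i ∈ Finset.range m, π := by
      rw [Finset.sum_const, Finset.card_range, nsmul_eq_mul, Nat.cast_comm]
    rw [hconst, ← Finset.sum_sub_distrib]
    refine Finset.dvd_sum fun i hi => ?_
    have : θ ^ i * π * θ ^ (m - i) - π = (θ ^ i * π - π * θ ^ i) * θ ^ (m - i) := by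
      rw [sub_mul, mul_assoc π, ← pow_add, Nat.add_sub_cancel' (Finset.mem_range.1 hi).le, hθ,
        mul_one]
    rw [this]
    exact (hcomm _).mul_right _
  obtain ⟨v, hv⟩ := hsum
  have hw : π * (m + π * v) = ∑ i ∈ Finset.range m, θ ^ i * π * θ ^ (m - i) := by
    rw [mul_add, ← mul_assoc, ← pow_two, ← hv, add_sub_cancel]
  refine ⟨m + π * v, ?_, hw ▸ commute_sum_pow_mul_mul_pow hθ π⟩
  by_contra h
  rw [hπ, dvd_add_left (dvd_mul_right _ _), ← hπ] at h
  exact h hm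

end Local

/-- A finite centrally essential ring with only trivial idempotents whose principal right
ideals satisfy the distributivity criterion is commutative. -/
theorem IsCentrallyEssential.mul_comm_of_trivial_idempotents {A : Type*} [Ring A] [Finite A]
    (hA : IsCentrallyEssential A)
    (hdist : ∀ a b : A, ∃ x y : A, x + y = 1 ∧ b ∣ a * x ∧ a ∣ b * y)
    (hidem : ∀ e : A, IsIdempotentElem e → e = 0 ∨ e = 1) (x y : A) : x * y = y * x := by
  nontriviality A
  have hloc : ∀ a : A, IsNilpotent a ∨ IsUnit a := fun a => by
    obtain ⟨n, hn, h⟩ := exists_pow_isIdempotentElem a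
    exact (hidem _ h).imp (fun h => ⟨n, h⟩) fun h => IsUnit.of_pow_eq_one h hn
  have hchain : ∀ a b : A, a ∣ b ∨ b ∣ a := by
    intro a b
    obtain ⟨x, y, hxy, hx, hy⟩ := hdist a b
    rcases hloc x with h | h
    · have hyu : IsUnit y := by
        rw [eq_sub_of_add_eq' hxy]
        exact h.isUnit_one_sub
      obtain ⟨u, rfl⟩ := hyu
      exact Or.inl ((Units.dvd_mul_right (u := u)).1 hy)
    · obtain ⟨u, rfl⟩ := h
      exact Or.inr ((Units.dvd_mul_right (u := u)).1 hx)
  obtain ⟨π, hπ, hmax⟩ := (Set.toFinite {a : A | ¬IsUnit a}).exists_maximalFor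
    (fun a => {x | a ∣ x}) _ ⟨0, not_isUnit_zero⟩
  refine hA.mul_comm_of_nonunits_eq ((hloc π).resolve_right hπ)
    (fun x => ⟨fun hx => ?_, ?_⟩) x y
  · rcases hchain π x with h | h
    · exact h
    · exact hmax hx (fun y hy => h.trans hy) (dvd_refl x)
  · rintro ⟨b, rfl⟩ h
    exact hπ (isUnit_of_mul_isUnit_left h)

/-- Elementwise form of the main theorem, proved by splitting off central idempotents. -/
theorem IsCentrallyEssential.mul_comm_of_exists_add_eq_one {A : Type*} [Ring A] [Finite A]
    (hA : IsCentrallyEssential A)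
    (hdist : ∀ a b : A, ∃ x y : A, x + y = 1 ∧ b ∣ a * x ∧ a ∣ b * y) (x y : A) :
    x * y = y * x := by
  induction hN : Nat.card A using Nat.strong_induction_on generalizing A with | _ N ih
  by_cases hidem : ∀ e : A, IsIdempotentElem e → e = 0 ∨ e = 1
  · exact hA.mul_comm_of_trivial_idempotents hdist hidem x y
  push Not at hidem
  obtain ⟨e, he, he0, he1⟩ := hidem
  have key : ∀ e : A, IsIdempotentElem e → e ≠ 1 → e * (x * y) = e * (y * x) := by
    intro e he he1
    have hcen := hA.mul_comm_of_isIdempotentElem he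
    have hmem : ∀ a, e * a ∈ Subsemigroup.corner e := fun a =>
      (Subsemigroup.mem_corner_iff he).2
        ⟨by rw [← mul_assoc, he.eq], by rw [mul_assoc, ← hcen, ← mul_assoc, he.eq]⟩
    have hcor : ∀ a : he.Corner, e * a.1 = a.1 := fun a =>
      ((Subsemigroup.mem_corner_iff he).1 a.2).1
    have : Finite he.Corner := inferInstanceAs (Finite (Subsemigroup.corner e))
    have hlt : Nat.card he.Corner < N := by
      rw [← hN]
      refine Finite.card_subtype_lt (x := (1 : A)) fun h => he1 ?_
      simpa using ((Subsemigroup.mem_corner_iff he).1 h).1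
    have hcenter : ∀ z : he.Corner, z.1 ∈ Set.center A → z ∈ Set.center he.Corner := fun z hz =>
      Semigroup.mem_center_iff.2 fun b => Subtype.ext (Semigroup.mem_center_iff.1 hz b.1)
    have hCE : IsCentrallyEssential he.Corner := by
      intro a ha
      obtain ⟨c, d, hc, hd, -, hd0, h⟩ := hA a.1 fun h => ha (Subtype.ext h)
      have had : a.1 * (e * c) = d := by rw [← mul_assoc, ← hcen, hcor, h]
      have hed : e * d = d := by rw [← h, ← mul_assoc, hcor]
      refine ⟨⟨e * c, hmem c⟩, ⟨d, hed ▸ hmem d⟩,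
        hcenter _ (Set.mul_mem_center (Semigroup.mem_center_iff.2 fun a => (hcen a).symm) hc),
        hcenter _ hd, ?_, ?_, Subtype.ext had⟩
      · intro h0
        refine hd0 ?_
        rw [← had, show e * c = 0 from congrArg Subtype.val h0, mul_zero]
      · exact fun h0 => hd0 (congrArg Subtype.val h0)
    have hD : ∀ a b : he.Corner, ∃ x y : he.Corner, x + y = 1 ∧ b ∣ a * x ∧ a ∣ b * y := by
      intro a b
      obtain ⟨x, y, hxy, ⟨s, hs⟩, ⟨t, ht⟩⟩ := hdist a.1 b.1
      have hswap : ∀ (a : he.Corner) (x : A), a.1 * (e * x) = a.1 * x := fun a x => by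
        rw [← mul_assoc, ← hcen, hcor]
      refine ⟨⟨e * x, hmem x⟩, ⟨e * y, hmem y⟩, Subtype.ext ?_, ⟨⟨e * s, hmem s⟩, Subtype.ext ?_⟩,
        ⟨⟨e * t, hmem t⟩, Subtype.ext ?_⟩⟩
      · change e * x + e * y = e
        rw [← mul_add, hxy, mul_one]
      · exact (hswap a x).trans (hs.trans (hswap b s).symm)
      · exact (hswap b y).trans (ht.trans (hswap a t).symm)
    have h := congrArg Subtype.val
      (ih _ hlt hCE hD ⟨e * x, hmem x⟩ ⟨e * y, hmem y⟩ rfl)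
    have hmul : ∀ x y, e * x * (e * y) = e * (x * y) := fun x y => by
      rw [← mul_assoc, mul_assoc e x e, ← hcen, ← mul_assoc, he.eq, mul_assoc]
    exact (hmul x y).symm.trans (h.trans (hmul y x))
  have h1 := key e he he1
  have h2 := key (1 - e) he.one_sub (by simpa using he0)
  simpa [sub_mul, h1] using h2

/-- Every finite, right distributive, centrally essential ring is commutative. -/
theorem finite_rightDistributive_centrallyEssential_comm {A : Type*} [Ring A]
    [Nontrivial A] [Finite A]
    (hdist : IsRightDistributive A) (hCE : IsCentrallyEssential A) :
    ∀ x y : A, x * y = y * x :=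
  hCE.mul_comm_of_exists_add_eq_one hdist.exists_add_eq_one
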